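/- Chertkov–Chernyak form of the loop series expansion: For every finite simple graph G = (V,E) with a consistent positive pseudo-marginal assignment, Σ_{σ : V → {−1,+1}} Π_{{i,j} ∈ E} b_{ij}(σ_i, σ_j) · Π_{i ∈ V} b_i(σ_i)^{1 − d_i} = Σ_{C ⊆ E} ( Π_{{i,j} ∈ C} τ_{ij} ) · ( Π_{i ∈ V : d_i(C) ≥ 1} ρ_i(C) ), where the empty edge subset contributes 1, m_i := b_i(+1) − b_i(−1), τ_{ij} := Σ_{x,y ∈ {−1,+1}} b_{ij}(x,y)(x − m_i)(y − m_j), and for d_i(C) ≥ 1, ρ_i(C) := ((1 − m_i)^{d_i(C)−1} + (−1)^{d_i(C)} (1 + m_i)^{d_i(C)−1}) / (2 (1 − m_i^2)^{d_i(C)−1}). -/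

import Mathlib

/-- A product over loopless edges of endpoint weights, regrouped by vertices. -/
theorem prod_endpoints_eq_prod_pow_degree {V : Type*} [Fintype V] [DecidableEq V]
    (C : Finset (V × V)) (hC : ∀ p ∈ C, p.1 ≠ p.2) (f : V → ℝ) :
    ∏ p ∈ C, f p.1 * f p.2 =
      ∏ i : V, f i ^ (C.filter (fun p => p.1 = i ∨ p.2 = i)).card := by
  have key (p : V × V) (hp : p ∈ C) :
      f p.1 * f p.2 = ∏ i : V, if p.1 = i ∨ p.2 = i then f i else 1 := by
    rw [← Finset.prod_filter, ← Finset.prod_pair (hC p hp)]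
    congr 1
    ext i
    simp [eq_comm]
  rw [Finset.prod_congr rfl key, Finset.prod_comm]
  refine Finset.prod_congr rfl fun i _ => ?_
  rw [← Finset.prod_filter, Finset.prod_const]

/-- A pseudo-marginal table on `{-1, 1} × {-1, 1}` in terms of its marginals `u`, `v` and its
covariance `t`. -/
theorem pairwise_marginal_eq (b : ℝ → ℝ → ℝ) (u v : ℝ → ℝ) (k l t : ℝ)
    (hu : 0 < u 1 ∧ 0 < u (-1)) (hv : 0 < v 1 ∧ 0 < v (-1))
    (hu1 : u 1 + u (-1) = 1) (hv1 : v 1 + v (-1) = 1)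
    (hbu : ∀ x ∈ ({-1, 1} : Finset ℝ), b x 1 + b x (-1) = u x)
    (hbv : ∀ y ∈ ({-1, 1} : Finset ℝ), b 1 y + b (-1) y = v y)
    (hk : k = u 1 - u (-1)) (hl : l = v 1 - v (-1))
    (ht : t = ∑ x ∈ ({-1, 1} : Finset ℝ), ∑ y ∈ ({-1, 1} : Finset ℝ),
      b x y * (x - k) * (y - l))
    {x y : ℝ} (hx : x ∈ ({-1, 1} : Finset ℝ)) (hy : y ∈ ({-1, 1} : Finset ℝ)) :
    b x y = u x * v y * (1 + t * ((x - k) / (1 - k ^ 2) * ((y - l) / (1 - l ^ 2)))) := by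
  have hne : (-1 : ℝ) ≠ 1 := by norm_num
  have h1 := hbu 1 (by simp)
  have h2 := hbu (-1) (by simp)
  have h3 := hbv 1 (by simp)
  have weight (w : ℝ → ℝ) (n : ℝ) (hw : 0 < w 1 ∧ 0 < w (-1)) (hw1 : w 1 + w (-1) = 1)
      (hn : n = w 1 - w (-1)) {z : ℝ} (hz : z ∈ ({-1, 1} : Finset ℝ)) :
      w z * ((z - n) / (1 - n ^ 2)) = z / 2 := by
    have e : 1 - n ^ 2 = 4 * (w 1 * w (-1)) := by
      rw [hn]; linear_combination (-1 - w 1 - w (-1)) * hw1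
    have hp := hw.1.ne'
    have hq := hw.2.ne'
    have hs : w (-1) = 1 - w 1 := by linarith
    rw [e, hn]
    simp only [Finset.mem_insert, Finset.mem_singleton] at hz
    rcases hz with rfl | rfl
    · field_simp
      rw [hs]; ring
    · field_simp
      rw [hs]; ring
  have hU := weight u k hu hu1 hk hx
  have hV := weight v l hv hv1 hl hy
  have expand : u x * v y * (1 + t * ((x - k) / (1 - k ^ 2) * ((y - l) / (1 - l ^ 2)))) =
      u x * v y + t * (x / 2) * (y / 2) := by
    rw [← hU, ← hV]; ring
  rw [expand, ht]
  simp only [Finset.sum_pair hne]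
  have e1 : b 1 (-1) = u 1 - b 1 1 := by linarith
  have e2 : b (-1) 1 = v 1 - b 1 1 := by linarith
  have e3 : u (-1) = 1 - u 1 := by linarith
  have e4 : v (-1) = 1 - v 1 := by linarith
  have e5 : b (-1) (-1) = 1 - u 1 - v 1 + b 1 1 := by linarith
  simp only [Finset.mem_insert, Finset.mem_singleton] at hx hy
  rcases hx with rfl | rfl <;> rcases hy with rfl | rfl <;>
    · simp only [hk, hl, e1, e2, e3, e4, e5]
      ring

/-- The moments of the normalised centred spin. -/
theorem sum_weight_mul_pow (u : ℝ → ℝ) (k : ℝ) (hu : 0 < u 1 ∧ 0 < u (-1))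
    (hu1 : u 1 + u (-1) = 1) (hk : k = u 1 - u (-1)) (d : ℕ) :
    ∑ x : ({-1, 1} : Finset ℝ), u x * (((x : ℝ) - k) / (1 - k ^ 2)) ^ d =
      if 1 ≤ d then
        ((1 - k) ^ (d - 1) + (-1 : ℝ) ^ d * (1 + k) ^ (d - 1)) / (2 * (1 - k ^ 2) ^ (d - 1))
      else 1 := by
  have hne : (-1 : ℝ) ≠ 1 := by norm_num
  rw [Finset.sum_coe_sort ({-1, 1} : Finset ℝ) fun x => u x * ((x - k) / (1 - k ^ 2)) ^ d,
    Finset.sum_pair hne]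
  cases d with
  | zero => simp; linarith
  | succ n =>
    have hp : 1 + k ≠ 0 := by linarith [hu.1]
    have hq : 1 - k ≠ 0 := by linarith [hu.2]
    have hup : u 1 = (1 + k) / 2 := by linarith
    have huq : u (-1) = (1 - k) / 2 := by linarith
    have hfac : 1 - k ^ 2 = (1 - k) * (1 + k) := by ring
    have ha : (-1 - k) / (1 - k ^ 2) = -1 / (1 - k) := by
      rw [hfac]; field_simp; ring
    have hb : (1 - k) / (1 - k ^ 2) = 1 / (1 + k) := by
      rw [hfac]; field_simp
    rw [ha, hb, hup, huq, hfac]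
    simp only [le_add_iff_nonneg_left, zero_le, if_true, Nat.add_sub_cancel, mul_pow, div_pow,
      one_pow, pow_succ]
    field_simp
    ring

/-- Chertkov–Chernyak form of the loop series expansion: for a finite simple graph (edges
given by the finset `E` of ordered pairs, each edge appearing with exactly one orientation)
with a consistent positive pseudo-marginal assignment `(b1, b2)`, the partition function
equals `Σ_{C⊆E} (Π_{(i,j)∈C} τ i j)(Π_{i : dᵢ(C) ≥ 1} ρ_i(C))`. -/
theorem loop_series_expansion_chertkov_chernyak {V : Type*} [Fintype V] [DecidableEq V]
    (E : Finset (V × V))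
    (hirr : ∀ p ∈ E, p.1 ≠ p.2)
    (hasym : ∀ p ∈ E, (p.2, p.1) ∉ E)
    (b1 : V → ℝ → ℝ) (b2 : V → V → ℝ → ℝ → ℝ)
    (hb1pos : ∀ i : V, 0 < b1 i 1 ∧ 0 < b1 i (-1))
    (hb1sum : ∀ i : V, b1 i 1 + b1 i (-1) = 1)
    (hb2pos : ∀ p ∈ E, ∀ x ∈ ({-1, 1} : Finset ℝ), ∀ y ∈ ({-1, 1} : Finset ℝ),
      0 < b2 p.1 p.2 x y)
    (hb2sym : ∀ i j : V, ∀ x y : ℝ, b2 i j x y = b2 j i y x)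
    (hcons₁ : ∀ p ∈ E, ∀ x ∈ ({-1, 1} : Finset ℝ),
      b2 p.1 p.2 x 1 + b2 p.1 p.2 x (-1) = b1 p.1 x)
    (hcons₂ : ∀ p ∈ E, ∀ y ∈ ({-1, 1} : Finset ℝ),
      b2 p.1 p.2 1 y + b2 p.1 p.2 (-1) y = b1 p.2 y)
    (m : V → ℝ) (hm : ∀ i : V, m i = b1 i 1 - b1 i (-1))
    (τ : V → V → ℝ)
    (hτ : ∀ i j : V, τ i j = ∑ x ∈ ({-1, 1} : Finset ℝ), ∑ y ∈ ({-1, 1} : Finset ℝ),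
      b2 i j x y * (x - m i) * (y - m j)) :
    ∑ σ : V → ({-1, 1} : Finset ℝ),
        (∏ p ∈ E, b2 p.1 p.2 (σ p.1 : ℝ) (σ p.2 : ℝ)) *
          ∏ i : V, (b1 i (σ i : ℝ)) ^
            ((1 : ℤ) - ((E.filter (fun p => p.1 = i ∨ p.2 = i)).card : ℤ)) =
      ∑ C ∈ E.powerset,
        (∏ p ∈ C, τ p.1 p.2) *
          ∏ i ∈ Finset.univ.filter
              (fun i : V => 1 ≤ (C.filter (fun p => p.1 = i ∨ p.2 = i)).card),
            (((1 - m i) ^ ((C.filter (fun p => p.1 = i ∨ p.2 = i)).card - 1) +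
                (-1 : ℝ) ^ ((C.filter (fun p => p.1 = i ∨ p.2 = i)).card) *
                  (1 + m i) ^ ((C.filter (fun p => p.1 = i ∨ p.2 = i)).card - 1)) /
              (2 * (1 - m i ^ 2) ^ ((C.filter (fun p => p.1 = i ∨ p.2 = i)).card - 1))) := by
  set g : V → ℝ → ℝ := fun i x => (x - m i) / (1 - m i ^ 2)
  have hpos (i : V) (x : ({-1, 1} : Finset ℝ)) : b1 i x ≠ 0 := by
    obtain ⟨x, hx⟩ := x
    simp only [Finset.mem_insert, Finset.mem_singleton] at hx
    rcases hx with rfl | rfl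
    · exact (hb1pos i).2.ne'
    · exact (hb1pos i).1.ne'
  have weight (σ : V → ({-1, 1} : Finset ℝ)) :
      (∏ p ∈ E, b2 p.1 p.2 (σ p.1 : ℝ) (σ p.2 : ℝ)) *
          ∏ i : V, (b1 i (σ i : ℝ)) ^
            ((1 : ℤ) - ((E.filter (fun p => p.1 = i ∨ p.2 = i)).card : ℤ)) =
        ∑ C ∈ E.powerset, (∏ p ∈ C, τ p.1 p.2) *
          ∏ i : V, b1 i (σ i) *
            g i (σ i) ^ (C.filter (fun p => p.1 = i ∨ p.2 = i)).card := by
    have edge (p : V × V) (hp : p ∈ E) : b2 p.1 p.2 (σ p.1 : ℝ) (σ p.2 : ℝ) =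
        b1 p.1 (σ p.1) * b1 p.2 (σ p.2) *
          (1 + τ p.1 p.2 * (g p.1 (σ p.1) * g p.2 (σ p.2))) :=
      pairwise_marginal_eq _ _ _ _ _ _ (hb1pos _) (hb1pos _) (hb1sum _) (hb1sum _)
        (hcons₁ p hp) (hcons₂ p hp) (hm _) (hm _) (hτ _ _) (σ p.1).2 (σ p.2).2
    have cancel : (∏ i : V, b1 i (σ i) ^ (E.filter (fun p => p.1 = i ∨ p.2 = i)).card) *
        ∏ i : V, (b1 i (σ i : ℝ)) ^
            ((1 : ℤ) - ((E.filter (fun p => p.1 = i ∨ p.2 = i)).card : ℤ)) =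
        ∏ i : V, b1 i (σ i) := by
      rw [← Finset.prod_mul_distrib]
      refine Finset.prod_congr rfl fun i _ => ?_
      rw [← zpow_natCast, ← zpow_add₀ (hpos i (σ i)), add_sub_cancel, zpow_one]
    rw [Finset.prod_congr rfl edge, Finset.prod_mul_distrib,
      prod_endpoints_eq_prod_pow_degree E hirr fun i => b1 i (σ i), mul_right_comm, cancel,
      Finset.prod_one_add, Finset.mul_sum]
    refine Finset.sum_congr rfl fun C hC => ?_
    rw [Finset.prod_mul_distrib (s := C),
      prod_endpoints_eq_prod_pow_degree C (fun p hp => hirr p (Finset.mem_powerset.1 hC hp))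
        fun i => g i (σ i), Finset.prod_mul_distrib]
    ring
  rw [Finset.sum_congr rfl fun σ _ => weight σ, Finset.sum_comm]
  refine Finset.sum_congr rfl fun C _ => ?_
  rw [← Finset.mul_sum, Finset.prod_filter]
  congr 1
  rw [← Fintype.prod_sum fun (i : V) (x : ({-1, 1} : Finset ℝ)) =>
    b1 i x * g i x ^ (C.filter (fun p => p.1 = i ∨ p.2 = i)).card]
  exact Finset.prod_congr rfl fun i _ =>
    sum_weight_mul_pow (b1 i) (m i) (hb1pos i) (hb1sum i) (hm i) _
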